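/- Let A : ℝ → ℝ^{n×n}, B : ℝ → ℝ^{n×m}, and P : ℝ → ℝ^{n×n} be differentiable at 0, with P(t) symmetric for all t, and let Q ∈ ℝ^{n×n} and symmetric R ∈ ℝ^{m×m} be fixed. Suppose that for all t in a neighborhood of 0, M(t) := R + B(t)ᵀ P(t) B(t) is invertible and the DARE residual vanishes: P(t) − Q − A(t)ᵀ P(t) A(t) + A(t)ᵀ P(t) B(t) M(t)^{-1} B(t)ᵀ P(t) A(t) = 0. Write A₀ = A(0), B₀ = B(0), P₀ = P(0), M₀ = M(0), K₀ = M₀^{-1} B₀ᵀ P₀ A₀, A_cl = A₀ − B₀ K₀, S = P'(0), 𝒜 = A'(0), ℬ = B'(0). Then S satisfies the discrete Lyapunov equation S − A_clᵀ S A_cl = (𝒜 − ℬ K₀)ᵀ P₀ A_cl + A_clᵀ P₀ (𝒜 − ℬ K₀). -/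

import Mathlib

open Matrix Filter

attribute [local instance] Matrix.normedAddCommGroup Matrix.normedSpace

section MatrixCalculus

variable {l m n : Type*}

theorem hasDerivAt_matrix_iff [Fintype n] {F : ℝ → Matrix l n ℝ} {F' : Matrix l n ℝ} {x : ℝ} :
    HasDerivAt F F' x ↔ ∀ i j, HasDerivAt (fun t => F t i j) (F' i j) x := by
  refine Iff.trans (hasDerivAt_pi (φ := F) (φ' := F')) (forall_congr' fun i => ?_)
  exact hasDerivAt_pi

theorem HasDerivAt.matrix_transpose [Fintype l] [Fintype n] {F : ℝ → Matrix l n ℝ}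
    {F' : Matrix l n ℝ} {x : ℝ}
    (hF : HasDerivAt F F' x) : HasDerivAt (fun t => (F t)ᵀ) F'ᵀ x :=
  hasDerivAt_matrix_iff.2 fun i j => hasDerivAt_matrix_iff.1 hF j i

theorem HasDerivAt.matrix_mul [Fintype m] [Fintype n] {F : ℝ → Matrix l m ℝ} {G : ℝ → Matrix m n ℝ}
    {F' : Matrix l m ℝ} {G' : Matrix m n ℝ} {x : ℝ}
    (hF : HasDerivAt F F' x) (hG : HasDerivAt G G' x) :
    HasDerivAt (fun t => F t * G t) (F' * G x + F x * G') x := by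
  rw [hasDerivAt_matrix_iff] at *
  intro i j
  simp only [Matrix.mul_apply, Matrix.add_apply, ← Finset.sum_add_distrib]
  exact HasDerivAt.fun_sum fun k _ => (hF i k).mul (hG k j)

theorem DifferentiableAt.matrix_det [Fintype n] [DecidableEq n] {F : ℝ → Matrix n n ℝ} {x : ℝ}
    (hF : ∀ i j, DifferentiableAt ℝ (fun t => F t i j) x) :
    DifferentiableAt ℝ (fun t => (F t).det) x := by
  simp only [Matrix.det_apply']
  fun_prop

theorem HasDerivAt.exists_matrix_inv [Fintype n] [DecidableEq n] {F : ℝ → Matrix n n ℝ}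
    {F' : Matrix n n ℝ} {x : ℝ} (hF : HasDerivAt F F' x) (hx : IsUnit (F x)) :
    ∃ D, HasDerivAt (fun t => (F t)⁻¹) D x := by
  have hF' i j : DifferentiableAt ℝ (fun t => F t i j) x :=
    (hasDerivAt_matrix_iff.1 hF i j).differentiableAt
  have hdet : (F x).det ≠ 0 := ((Matrix.isUnit_iff_isUnit_det _).1 hx).ne_zero
  have hinv i j : DifferentiableAt ℝ (fun t => (F t)⁻¹ i j) x := by
    simp only [Matrix.inv_def, Ring.inverse_eq_inv', Matrix.smul_apply, smul_eq_mul,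
      Matrix.adjugate_apply]
    refine ((DifferentiableAt.matrix_det hF').inv hdet).mul (DifferentiableAt.matrix_det ?_)
    intro a b
    by_cases h : a = j
    · subst h
      simp
    · simpa [Matrix.updateRow_ne h] using hF' a b
  exact ⟨Matrix.of fun i j => _root_.deriv (fun t => (F t)⁻¹ i j) x,
    hasDerivAt_matrix_iff.2 fun i j => (hinv i j).hasDerivAt⟩

end MatrixCalculus

/-- Completing the square in the Riccati residual around an arbitrary gain `K`. -/
theorem riccati_residual_eq {n m : Type*} [Fintype n] [Fintype m] [DecidableEq m]
    (A P Q : Matrix n n ℝ) (B : Matrix n m ℝ) (R : Matrix m m ℝ) (K : Matrix m n ℝ)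
    (hR : Rᵀ = R) (hP : Pᵀ = P) (hM : IsUnit (R + Bᵀ * P * B)) :
    P - Q - Aᵀ * P * A + Aᵀ * P * B * (R + Bᵀ * P * B)⁻¹ * Bᵀ * P * A
      = P - (A - B * K)ᵀ * P * (A - B * K)
        + (Bᵀ * P * A - (R + Bᵀ * P * B) * K)ᵀ * (R + Bᵀ * P * B)⁻¹
          * (Bᵀ * P * A - (R + Bᵀ * P * B) * K) - (Q + Kᵀ * R * K) := by
  have hdet := (Matrix.isUnit_iff_isUnit_det _).1 hM
  have hMt : (R + Bᵀ * P * B)ᵀ = R + Bᵀ * P * B := by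
    simp [Matrix.transpose_mul, hR, hP, Matrix.mul_assoc]
  have hRM : R = (R + Bᵀ * P * B) - Bᵀ * P * B := by abel
  have hKRK : Kᵀ * R * K = Kᵀ * (R + Bᵀ * P * B) * K - Kᵀ * (Bᵀ * P * B) * K := by
    rw [← Matrix.sub_mul, ← Matrix.mul_sub, ← hRM]
  rw [hKRK]
  generalize R + Bᵀ * P * B = M at *
  have h₁ (X : Matrix m n ℝ) : M⁻¹ * (M * X) = X := by
    rw [← Matrix.mul_assoc, Matrix.nonsing_inv_mul _ hdet, Matrix.one_mul]
  have h₂ (X : Matrix m n ℝ) : M * (M⁻¹ * X) = X := by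
    rw [← Matrix.mul_assoc, Matrix.mul_nonsing_inv _ hdet, Matrix.one_mul]
  simp only [Matrix.transpose_sub, Matrix.transpose_mul, hMt, hP, Matrix.transpose_transpose,
    Matrix.sub_mul, Matrix.mul_sub, Matrix.mul_assoc, h₁, h₂]
  abel

/-- **Riccati sensitivity via implicit differentiation.**
Let `A(t), B(t), P(t)` be matrix curves differentiable at `0` with `P(t)` symmetric, and
fixed `Q` and symmetric `R`.  Suppose for all `t` near `0` the matrix
`M(t) := R + B(t)ᵀ P(t) B(t)` is invertible and the DARE residual vanishes:
`P(t) - Q - A(t)ᵀ P(t) A(t) + A(t)ᵀ P(t) B(t) M(t)⁻¹ B(t)ᵀ P(t) A(t) = 0`.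
Writing `A₀ = A(0)`, `B₀ = B(0)`, `P₀ = P(0)`, `M₀ = M(0)`, `K₀ = M₀⁻¹ B₀ᵀ P₀ A₀`,
`A_cl = A₀ - B₀ K₀`, `S = P'(0)`, `𝒜 = A'(0)` (here `Ad`), `ℬ = B'(0)` (here `Bd`),
the sensitivity `S` satisfies the discrete Lyapunov equation
`S - A_clᵀ S A_cl = (𝒜 - ℬ K₀)ᵀ P₀ A_cl + A_clᵀ P₀ (𝒜 - ℬ K₀)`. -/
theorem riccati_sensitivity_lyapunov
    {n m : ℕ}
    (A : ℝ → Matrix (Fin n) (Fin n) ℝ) (B : ℝ → Matrix (Fin n) (Fin m) ℝ)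
    (P : ℝ → Matrix (Fin n) (Fin n) ℝ)
    (Q : Matrix (Fin n) (Fin n) ℝ) (R : Matrix (Fin m) (Fin m) ℝ)
    (hR : Rᵀ = R)
    (hPsymm : ∀ t, (P t)ᵀ = P t)
    (Ad : Matrix (Fin n) (Fin n) ℝ) (Bd : Matrix (Fin n) (Fin m) ℝ)
    (S : Matrix (Fin n) (Fin n) ℝ)
    (hA : HasDerivAt A Ad 0) (hB : HasDerivAt B Bd 0) (hP : HasDerivAt P S 0)
    (hMinv : ∀ᶠ t in nhds (0 : ℝ), IsUnit (R + (B t)ᵀ * P t * B t))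
    (hres : ∀ᶠ t in nhds (0 : ℝ),
      P t - Q - (A t)ᵀ * P t * A t
        + (A t)ᵀ * P t * B t * (R + (B t)ᵀ * P t * B t)⁻¹ * (B t)ᵀ * P t * A t = 0)
    (A₀ : Matrix (Fin n) (Fin n) ℝ) (hA₀ : A₀ = A 0)
    (B₀ : Matrix (Fin n) (Fin m) ℝ) (hB₀ : B₀ = B 0)
    (P₀ : Matrix (Fin n) (Fin n) ℝ) (hP₀ : P₀ = P 0)
    (M₀ : Matrix (Fin m) (Fin m) ℝ) (hM₀ : M₀ = R + B₀ᵀ * P₀ * B₀)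
    (K₀ : Matrix (Fin m) (Fin n) ℝ) (hK₀ : K₀ = M₀⁻¹ * B₀ᵀ * P₀ * A₀)
    (Acl : Matrix (Fin n) (Fin n) ℝ) (hAcl : Acl = A₀ - B₀ * K₀) :
    S - Aclᵀ * S * Acl
      = (Ad - Bd * K₀)ᵀ * P₀ * Acl + Aclᵀ * P₀ * (Ad - Bd * K₀) := by
  subst hA₀ hB₀ hP₀
  have hM : HasDerivAt (fun t => R + (B t)ᵀ * P t * B t) _ 0 :=
    ((hB.matrix_transpose.matrix_mul hP).matrix_mul hB).const_add R
  obtain ⟨D, hD⟩ := hM.exists_matrix_inv hMinv.self_of_nhds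
  have hN : HasDerivAt (fun t => (B t)ᵀ * P t * A t - (R + (B t)ᵀ * P t * B t) * K₀) _ 0 :=
    ((hB.matrix_transpose.matrix_mul hP).matrix_mul hA).sub
      (hM.matrix_mul (hasDerivAt_const 0 K₀))
  have hC : HasDerivAt (fun t => A t - B t * K₀) (Ad - Bd * K₀) 0 :=
    (hA.sub (hB.matrix_mul (hasDerivAt_const 0 K₀))).congr_deriv (by simp)
  have hN0 : (B 0)ᵀ * P 0 * A 0 - (R + (B 0)ᵀ * P 0 * B 0) * K₀ = 0 := by
    have hdet := (Matrix.isUnit_iff_isUnit_det _).1 hMinv.self_of_nhds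
    rw [hK₀, hM₀, sub_eq_zero]
    simp only [Matrix.mul_assoc] at hdet ⊢
    rw [← Matrix.mul_assoc _ _⁻¹, Matrix.mul_nonsing_inv _ hdet, Matrix.one_mul]
  have hF := ((hP.sub ((hC.matrix_transpose.matrix_mul hP).matrix_mul hC)).add
    ((hN.matrix_transpose.matrix_mul hD).matrix_mul hN)).sub_const (Q + K₀ᵀ * R * K₀)
  have hF0 := hF.unique <|
    (hasDerivAt_const (0 : ℝ) (0 : Matrix (Fin n) (Fin n) ℝ)).congr_of_eventuallyEq (by
      filter_upwards [hMinv, hres] with t ht hrt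
      exact (riccati_residual_eq _ _ _ _ _ K₀ hR (hPsymm t) ht).symm.trans hrt)
  simp only [hN0, Matrix.transpose_zero, Matrix.zero_mul, Matrix.mul_zero, add_zero, ← hAcl]
    at hF0
  rw [← sub_eq_zero, ← hF0, Matrix.add_mul]
  abel
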